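/- arXiv:2007.11138 — 2 statements merged into one kernel-verified Lean document; each statement's English description precedes it below -/
import Mathlib

section
/- Consider the Gaussian additive model with priors {P_N}, M_N → ∞, and set λ_N = 2 log M_N. Let Ω_N ⊆ ℝ^N × ℝ^N be any sequence of measurable events occurring with uniformly high probability at SNR λ_N, and let Q̃_{λ_N,N} denote the conditional law of Y = √λ_N·X + Z given the event (X, Y) ∈ Ω_N. Then D(Q_{λ_N,N} ‖ Q_{0,N}) ≤ D(Q̃_{λ_N,N} ‖ Q_{0,N}) + o(log M_N) as N → ∞. -/
open MeasureTheory ProbabilityTheory Filter Real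
open scoped ENNReal NNReal

noncomputable section

/-- Vectors in `ℝ^N`. -/
abbrev V (N : ℕ) : Type := Fin N → ℝ

/-- Euclidean inner product on `ℝ^N`. -/
def inp {N : ℕ} (x y : V N) : ℝ := ∑ i, x i * y i

/-- `S` is a subset of the unit sphere of `ℝ^N`. -/
def onSphere {N : ℕ} (S : Finset (V N)) : Prop := ∀ x ∈ S, ∑ i, (x i) ^ 2 = 1

/-- The standard Gaussian measure on `ℝ^N`. -/
def stdGaussian (N : ℕ) : Measure (V N) :=
  Measure.pi fun _ : Fin N => gaussianReal 0 1

/-- The uniform probability measure on a finite set of vectors. -/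
def unifOn {N : ℕ} (S : Finset (V N)) : Measure (V N) :=
  (S.card : ℝ≥0∞)⁻¹ • ∑ x ∈ S, Measure.dirac x

/-- The joint law of `(X, Y)` where `X` is uniform on `S`, `Z` is an independent standard
Gaussian vector, and `Y = √λ • X + Z`. -/
def jointLaw (N : ℕ) (S : Finset (V N)) (lam : ℝ) : Measure (V N × V N) :=
  ((unifOn S).prod (stdGaussian N)).map
    (fun q => (q.1, fun i => Real.sqrt lam * q.1 i + q.2 i))

/-- `Q N S lam` : the law of the observation `Y = √λ • X + Z`. -/
def Q (N : ℕ) (S : Finset (V N)) (lam : ℝ) : Measure (V N) :=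
  (jointLaw N S lam).map Prod.snd

/-- Kullback–Leibler divergence `D(μ ‖ ν) = ∫ log (dμ/dν) dμ` (real-valued). -/
def klReal {α : Type*} [MeasurableSpace α] (μ ν : Measure α) : ℝ :=
  ∫ x, Real.log (μ.rnDeriv ν x).toReal ∂μ

/-- The σ-algebra generated by the observation `Y` (the second coordinate). -/
def sigmaY (N : ℕ) : MeasurableSpace (V N × V N) :=
  MeasurableSpace.comap Prod.snd inferInstance

/-- The minimum mean squared error `E‖X - E[X | Y]‖²` at SNR `lam`. -/
def mmse (N : ℕ) (S : Finset (V N)) (lam : ℝ) : ℝ :=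
  ∑ i : Fin N,
    ∫ ω, (ω.1 i - ((jointLaw N S lam)[fun ω' => ω'.1 i | sigmaY N]) ω) ^ 2
      ∂(jointLaw N S lam)

/-- The all-or-nothing phenomenon with critical SNR sequence `lam`. -/
def allOrNothing (S : ∀ N : ℕ, Finset (V N)) (lam : ℕ → ℝ) : Prop :=
  (∀ β : ℝ, 0 ≤ β → β < 1 →
    Tendsto (fun N => mmse N (S N) (β * lam N)) atTop (nhds 1)) ∧
  (∀ β : ℝ, 1 < β →
    Tendsto (fun N => mmse N (S N) (β * lam N)) atTop (nhds 0))

/-- `limsup_N (1 / log M_N) · log P_N^{⊗2}[⟨X, X'⟩ ≥ t] ≤ c`, where `X, X'` are i.i.d.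
draws from the uniform distribution on `S N`: for every `ε > 0`, eventually the probability
that the overlap is at least `t` is at most `M_N ^ (c + ε)`. -/
def overlapRateLe (S : ∀ N : ℕ, Finset (V N)) (t c : ℝ) : Prop :=
  ∀ ε : ℝ, 0 < ε → ∀ᶠ N in atTop,
    ((unifOn (S N)).prod (unifOn (S N))) {q | t ≤ inp q.1 q.2}
      ≤ ((S N).card : ℝ≥0∞) ^ (c + ε)

/-- The spread assumption: `lim_{t→1⁻} limsup_N (1/log M_N) log P_N^{⊗2}[⟨X,X'⟩ ≥ t] ≤ -1`. -/
def spread (S : ∀ N : ℕ, Finset (V N)) : Prop :=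
  ∀ ε : ℝ, 0 < ε → ∃ t₀ : ℝ, t₀ < 1 ∧ ∀ t : ℝ, t₀ < t → t < 1 →
    overlapRateLe S t (-1 + ε)

/-- A sequence of events `Ω_N ⊆ ℝ^N × ℝ^N` occurs with uniformly high probability at SNR
`λ_N` if `sup_{x ∈ S_N} Pr_Z[(x, √λ_N x + Z) ∉ Ω_N] → 0` as `N → ∞`. -/
def uniformlyHigh (S : ∀ N : ℕ, Finset (V N)) (lam : ℕ → ℝ)
    (Om : ∀ N : ℕ, Set (V N × V N)) : Prop :=
  ∀ ε : ℝ, 0 < ε → ∀ᶠ N in atTop, ∀ x ∈ S N,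
    stdGaussian N {z | (x, fun i => Real.sqrt (lam N) * x i + z i) ∉ Om N}
      ≤ ENNReal.ofReal ε

/-- The conditional law `Q̃` of the observation `Y`, given that `(X, Y)` lies in the
event `Om`. -/
def condQ (N : ℕ) (S : Finset (V N)) (lam : ℝ) (Om : Set (V N × V N)) : Measure (V N) :=
  ((jointLaw N S lam)[|Om]).map Prod.snd

lemma gauss_shift_one (c : ℝ) :
    gaussianReal c 1 = (gaussianReal 0 1).withDensity
      (fun y => ENNReal.ofReal (Real.exp (c * y - c ^ 2 / 2))) := by
  rw [gaussianReal_of_var_ne_zero c one_ne_zero, gaussianReal_of_var_ne_zero 0 one_ne_zero,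
    ← withDensity_mul _ (measurable_gaussianPDF 0 1) (by fun_prop)]
  congr 1
  ext y
  simp only [Pi.mul_apply, gaussianPDF]
  rw [← ENNReal.ofReal_mul (gaussianPDFReal_nonneg _ _ _)]
  congr 1
  simp only [gaussianPDFReal]
  rw [mul_assoc (√(2 * π * ((1 : ℝ≥0) : ℝ)))⁻¹, ← Real.exp_add]
  congr 2
  simp
  ring

lemma gauss_integrable_one (c : ℝ) :
    Integrable (fun y => Real.exp (c * y - c ^ 2 / 2)) (gaussianReal 0 1) := by
  have := (integrable_exp_mul_gaussianReal (μ := 0) (v := 1) c).mul_const (Real.exp (-(c^2/2)))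
  refine this.congr (ae_of_all _ fun y => ?_)
  simp only [← Real.exp_add]
  congr 1

lemma gauss_shift (N : ℕ) (c : V N) :
    (_root_.stdGaussian N).map (fun z i => c i + z i) = (_root_.stdGaussian N).withDensity
      (fun y => ENNReal.ofReal (∏ i, Real.exp (c i * y i - c i ^ 2 / 2))) := by
  have h1 : (_root_.stdGaussian N).map (fun z i => c i + z i)
      = Measure.pi (fun i => gaussianReal (c i) 1) := by
    rw [_root_.stdGaussian, Measure.pi_map_pi (f := fun i z => c i + z)]
    · congr 1
      ext1 i
      rw [gaussianReal_map_const_add, zero_add]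
    · intro i; fun_prop
  rw [h1]
  refine Measure.pi_eq fun s hs => ?_
  rw [withDensity_apply _ (MeasurableSet.univ_pi hs), _root_.stdGaussian, Measure.restrict_pi_pi,
    ← ofReal_integral_eq_lintegral_ofReal]
  · rw [integral_fintype_prod_eq_prod (f := fun i y => Real.exp (c i * y - c i ^ 2 / 2)),
      ENNReal.ofReal_prod_of_nonneg (fun i _ => integral_nonneg fun y => (Real.exp_pos _).le)]
    refine Finset.prod_congr rfl fun i _ => ?_
    rw [ofReal_integral_eq_lintegral_ofReal (gauss_integrable_one _).restrict
      (ae_of_all _ fun y => (Real.exp_pos _).le), gauss_shift_one (c i),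
      withDensity_apply _ (hs i)]
  · exact Integrable.fintype_prod_dep (f := fun i y => Real.exp (c i * y - c i ^ 2 / 2))
      (fun i => (gauss_integrable_one _).restrict)
  · exact ae_of_all _ fun y => Finset.prod_nonneg fun i _ => (Real.exp_pos _).le

/-- likelihood ratio -/
def gg {N : ℕ} (lam : ℝ) (x y : V N) : ℝ := Real.exp (Real.sqrt lam * inp x y - lam / 2)

lemma measurable_gg {N : ℕ} (lam : ℝ) (x : V N) : Measurable (gg lam x) := by
  unfold gg inp; fun_prop

lemma gg_prod {N : ℕ} {lam : ℝ} (hl : 0 ≤ lam) {x : V N} (hx : ∑ i, (x i) ^ 2 = 1) (y : V N) :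
    gg lam x y = ∏ i, Real.exp ((Real.sqrt lam * x i) * y i - (Real.sqrt lam * x i) ^ 2 / 2) := by
  rw [← Real.exp_sum, gg, inp]
  congr 1
  rw [Finset.sum_sub_distrib, Finset.mul_sum, ← Finset.sum_div]
  simp_rw [mul_pow, ← Finset.mul_sum, hx, Real.sq_sqrt hl, mul_one]
  congr 1
  rw [Finset.mul_sum]
  exact Finset.sum_congr rfl fun i _ => by ring

instance (N : ℕ) : IsProbabilityMeasure (_root_.stdGaussian N) := by
  unfold _root_.stdGaussian; infer_instance

lemma shift_gg {N : ℕ} {lam : ℝ} (hl : 0 ≤ lam) {x : V N} (hx : ∑ i, (x i) ^ 2 = 1) :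
    (_root_.stdGaussian N).map (fun z i => Real.sqrt lam * x i + z i) = (_root_.stdGaussian N).withDensity
      (fun y => ENNReal.ofReal (gg lam x y)) := by
  rw [gauss_shift]
  simp_rw [gg_prod hl hx]

lemma gg_sq {N : ℕ} {lam : ℝ} (hl : 0 ≤ lam) {x : V N} (hx : ∑ i, (x i) ^ 2 = 1) (y : V N) :
    gg lam x y ^ 2 = Real.exp lam * ∏ i, Real.exp ((2 * (Real.sqrt lam * x i)) * y i
      - (2 * (Real.sqrt lam * x i)) ^ 2 / 2) := by
  rw [← Real.exp_sum, gg, inp, ← Real.exp_add, ← Real.exp_nat_mul]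
  congr 1
  rw [Finset.sum_sub_distrib, ← Finset.sum_div]
  simp_rw [mul_pow, ← Finset.mul_sum, hx, Real.sq_sqrt hl, mul_assoc, ← Finset.mul_sum]
  push_cast
  ring

lemma gauss_integral_one (c : ℝ) :
    ∫ y, Real.exp (c * y - c ^ 2 / 2) ∂(gaussianReal 0 1) = 1 := by
  have h := congrFun (mgf_fun_id_gaussianReal (μ := 0) (v := 1)) c
  simp only [mgf] at h
  simp_rw [sub_eq_add_neg, Real.exp_add, integral_mul_const]
  rw [h, ← Real.exp_add]
  simp

lemma integrable_gg_sq {N : ℕ} {lam : ℝ} (hl : 0 ≤ lam) {x : V N} (hx : ∑ i, (x i) ^ 2 = 1) :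
    Integrable (fun y => gg lam x y ^ 2) (_root_.stdGaussian N) := by
  simp_rw [gg_sq hl hx]
  exact (Integrable.fintype_prod_dep
    (f := fun i y => Real.exp ((2 * (Real.sqrt lam * x i)) * y
      - (2 * (Real.sqrt lam * x i)) ^ 2 / 2)) (fun i => (gauss_integrable_one _))).const_mul _

lemma integral_gg_sq {N : ℕ} {lam : ℝ} (hl : 0 ≤ lam) {x : V N} (hx : ∑ i, (x i) ^ 2 = 1) :
    ∫ y, gg lam x y ^ 2 ∂(_root_.stdGaussian N) = Real.exp lam := by
  simp_rw [gg_sq hl hx, integral_const_mul, _root_.stdGaussian]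
  rw [integral_fintype_prod_eq_prod (f := fun i y => Real.exp ((2 * (Real.sqrt lam * x i)) * y
      - (2 * (Real.sqrt lam * x i)) ^ 2 / 2))]
  simp_rw [gauss_integral_one]
  simp

/-- Unnormalised density of `Y` on the event `Om`. -/
def dens {N : ℕ} (S : Finset (V N)) (lam : ℝ) (Om : Set (V N × V N)) (y : V N) : ℝ :=
  (S.card : ℝ)⁻¹ * ∑ x ∈ S, {y' | (x, y') ∈ Om}.indicator (gg lam x) y

lemma measurable_dens {N : ℕ} (S : Finset (V N)) (lam : ℝ) {Om : Set (V N × V N)}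
    (h : MeasurableSet Om) : Measurable (dens S lam Om) := by
  unfold dens
  refine Measurable.const_mul (Finset.measurable_sum _ fun x _ => ?_) _
  exact (measurable_gg lam x).indicator (measurable_prodMk_left h)

lemma gg_nonneg {N : ℕ} (lam : ℝ) (x y : V N) : 0 ≤ gg lam x y := (Real.exp_pos _).le

lemma dens_nonneg {N : ℕ} (S : Finset (V N)) (lam : ℝ) (Om : Set (V N × V N)) (y : V N) :
    0 ≤ dens S lam Om y := by
  refine mul_nonneg (by positivity) (Finset.sum_nonneg fun x _ => ?_)
  exact Set.indicator_nonneg (fun _ _ => gg_nonneg _ _ _) _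

lemma joint_apply {N : ℕ} (S : Finset (V N)) (lam : ℝ) {s : Set (V N × V N)}
    (hs : MeasurableSet s) :
    jointLaw N S lam s = (S.card : ℝ≥0∞)⁻¹ * ∑ x ∈ S,
      _root_.stdGaussian N {z | (x, fun i => Real.sqrt lam * x i + z i) ∈ s} := by
  have hm : Measurable (fun q : V N × V N => (q.1, fun i => Real.sqrt lam * q.1 i + q.2 i)) := by
    fun_prop
  rw [jointLaw, Measure.map_apply hm hs, Measure.prod_apply (hm hs), unifOn,
    lintegral_smul_measure, lintegral_finsetSum_measure]
  simp only [lintegral_dirac, smul_eq_mul]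
  rfl

lemma shift_apply {N : ℕ} {lam : ℝ} (hl : 0 ≤ lam) {x : V N} (hx : ∑ i, (x i) ^ 2 = 1)
    {s : Set (V N)} (hs : MeasurableSet s) :
    _root_.stdGaussian N {z | (fun i => Real.sqrt lam * x i + z i) ∈ s}
      = ∫⁻ y in s, ENNReal.ofReal (gg lam x y) ∂(_root_.stdGaussian N) := by
  rw [← withDensity_apply _ hs, ← shift_gg hl hx, Measure.map_apply (by fun_prop) hs]
  rfl

lemma restrict_map {N : ℕ} {S : Finset (V N)} (hS : onSphere S) (h0 : S.card ≠ 0)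
    {lam : ℝ} (hl : 0 ≤ lam) {Om : Set (V N × V N)} (h : MeasurableSet Om) :
    ((jointLaw N S lam).restrict Om).map Prod.snd
      = (_root_.stdGaussian N).withDensity (fun y => ENNReal.ofReal (dens S lam Om y)) := by
  ext T hT
  rw [Measure.map_apply measurable_snd hT, Measure.restrict_apply (measurable_snd hT),
    joint_apply S lam ((measurable_snd hT).inter h), withDensity_apply _ hT]
  have e : ∀ y, ENNReal.ofReal (dens S lam Om y) = (S.card : ℝ≥0∞)⁻¹ * ∑ x ∈ S,
      {y' | (x, y') ∈ Om}.indicator (fun y => ENNReal.ofReal (gg lam x y)) y := by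
    intro y
    rw [dens, ENNReal.ofReal_mul (by positivity), ENNReal.ofReal_inv_of_pos
      (by positivity), ENNReal.ofReal_natCast, ENNReal.ofReal_sum_of_nonneg]
    · congr 2
      ext x
      by_cases hy : (x, y) ∈ Om <;> simp [Set.indicator, hy]
    · exact fun x _ => Set.indicator_nonneg (fun _ _ => gg_nonneg _ _ _) _
  simp_rw [e]
  have hg : ∀ x : V N, Measurable (fun y => ENNReal.ofReal (gg lam x y)) :=
    fun x => (measurable_gg lam x).ennreal_ofReal
  have hO : ∀ x : V N, MeasurableSet {y' | (x, y') ∈ Om} := fun x => measurable_prodMk_left h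
  rw [lintegral_const_mul _ (Finset.measurable_sum _ fun x _ => (hg x).indicator (hO x)),
    lintegral_finsetSum _ fun x _ => (hg x).indicator (hO x)]
  congr 1
  refine Finset.sum_congr rfl fun x hx => ?_
  rw [lintegral_indicator (hO x), Measure.restrict_restrict (hO x),
    Set.inter_comm {y' | (x, y') ∈ Om} T,
    ← shift_apply hl (hS x hx) (hT.inter (hO x))]
  rfl

lemma kl_withDensity {α : Type*} [MeasurableSpace α] (γ : Measure α) [IsProbabilityMeasure γ]
    {f : α → ℝ} (hf : Measurable f) (h0 : ∀ y, 0 ≤ f y) :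
    klReal (γ.withDensity (fun y => ENNReal.ofReal (f y))) γ = ∫ y, f y * Real.log (f y) ∂γ := by
  unfold klReal
  have hr := Measure.rnDeriv_withDensity γ hf.ennreal_ofReal
  have hr' := (withDensity_absolutelyContinuous γ (fun y => ENNReal.ofReal (f y))).ae_eq hr
  rw [integral_congr_ae (g := fun y => Real.log (f y))]
  · rw [integral_withDensity_eq_integral_toReal_smul hf.ennreal_ofReal (by simp)]
    simp [h0]
  · filter_upwards [hr'] with y hy
    rw [hy, ENNReal.toReal_ofReal (h0 y)]

lemma xlogx_mid {a b : ℝ} (ha : 0 ≤ a) (hb : 0 ≤ b) :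
    (a + b) * Real.log (a + b) ≤ a * Real.log a + b * Real.log b + (a + b) * Real.log 2 := by
  have h := Real.convexOn_mul_log.2 (show 2 * a ∈ Set.Ici (0 : ℝ) by simpa using ha)
    (show 2 * b ∈ Set.Ici (0 : ℝ) by simpa using hb)
    (show (0 : ℝ) ≤ 1 / 2 by norm_num) (show (0 : ℝ) ≤ 1 / 2 by norm_num) (by norm_num)
  simp only [smul_eq_mul] at h
  have e : ∀ t : ℝ, t * Real.log (2 * t) = t * Real.log t + t * Real.log 2 := by
    intro t
    rcases eq_or_ne t 0 with rfl | ht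
    · simp
    · rw [Real.log_mul two_ne_zero ht]; ring
  have e1 : (1 / 2 * (2 * a) + 1 / 2 * (2 * b)) = a + b := by ring
  rw [e1] at h
  have := e a
  have := e b
  nlinarith

lemma xlogx_abs {a : ℝ} (ha : 0 ≤ a) : |a * Real.log a| ≤ 1 + a ^ 2 := by
  rcases eq_or_lt_of_le ha with rfl | h
  · simp
  have h1 := Real.log_le_sub_one_of_pos h
  have h2 := Real.one_sub_inv_le_log_of_pos h
  have h3 : a * a⁻¹ = 1 := mul_inv_cancel₀ h.ne'
  rw [abs_le]
  constructor <;> nlinarith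

lemma dens_sq_le {N : ℕ} (S : Finset (V N)) (h0 : S.card ≠ 0) (lam : ℝ) (Om : Set (V N × V N))
    (y : V N) : dens S lam Om y ^ 2 ≤ (S.card : ℝ)⁻¹ * ∑ x ∈ S, gg lam x y ^ 2 := by
  have hc : (0 : ℝ) < S.card := by positivity
  have h1 : (∑ x ∈ S, {y' | (x, y') ∈ Om}.indicator (gg lam x) y) ^ 2
      ≤ (S.card : ℝ) * ∑ x ∈ S, gg lam x y ^ 2 := by
    refine le_trans ?_ sq_sum_le_card_mul_sum_sq
    refine pow_le_pow_left₀
      (Finset.sum_nonneg fun x _ => Set.indicator_nonneg (fun _ _ => gg_nonneg _ _ _) _) ?_ 2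
    refine Finset.sum_le_sum fun x _ => ?_
    exact Set.indicator_le_self' (fun _ _ => gg_nonneg _ _ _) y
  rw [dens, mul_pow]
  calc ((S.card : ℝ)⁻¹) ^ 2 * (∑ x ∈ S, {y' | (x, y') ∈ Om}.indicator (gg lam x) y) ^ 2
      ≤ ((S.card : ℝ)⁻¹) ^ 2 * ((S.card : ℝ) * ∑ x ∈ S, gg lam x y ^ 2) := by gcongr
    _ = _ := by field_simp

section core
variable {N : ℕ} {S : Finset (V N)} {lam : ℝ} {Om : Set (V N × V N)}

lemma integrable_G (hS : onSphere S) (hl : 0 ≤ lam) :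
    Integrable (fun y => (S.card : ℝ)⁻¹ * ∑ x ∈ S, gg lam x y ^ 2) (_root_.stdGaussian N) :=
  (integrable_finsetSum _ fun x hx => integrable_gg_sq hl (hS x hx)).const_mul _

lemma integral_G (hS : onSphere S) (h0 : S.card ≠ 0) (hl : 0 ≤ lam) :
    ∫ y, (S.card : ℝ)⁻¹ * ∑ x ∈ S, gg lam x y ^ 2 ∂(_root_.stdGaussian N) = Real.exp lam := by
  have hc : (0 : ℝ) < S.card := by positivity
  rw [integral_const_mul, integral_finsetSum _ fun x hx => integrable_gg_sq hl (hS x hx),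
    Finset.sum_congr rfl fun x hx => integral_gg_sq hl (hS x hx)]
  simp
  field_simp

lemma integrable_dens_sq (hS : onSphere S) (h0 : S.card ≠ 0) (hl : 0 ≤ lam)
    (h : MeasurableSet Om) :
    Integrable (fun y => dens S lam Om y ^ 2) (_root_.stdGaussian N) := by
  refine (integrable_G hS hl).mono' ((measurable_dens S lam h).pow_const 2).aestronglyMeasurable
    (ae_of_all _ fun y => ?_)
  rw [Real.norm_of_nonneg (sq_nonneg _)]
  exact dens_sq_le S h0 lam Om y

lemma integrable_dens (hS : onSphere S) (h0 : S.card ≠ 0) (hl : 0 ≤ lam)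
    (h : MeasurableSet Om) :
    Integrable (dens S lam Om) (_root_.stdGaussian N) := by
  refine ((integrable_const (1 : ℝ)).add (integrable_dens_sq hS h0 hl h)).mono'
    (measurable_dens S lam h).aestronglyMeasurable (ae_of_all _ fun y => ?_)
  rw [Real.norm_of_nonneg (dens_nonneg _ _ _ _), Pi.add_apply]
  nlinarith [sq_nonneg (dens S lam Om y - 1), dens_nonneg S lam Om y]

lemma integrable_dens_log (hS : onSphere S) (h0 : S.card ≠ 0) (hl : 0 ≤ lam)
    (h : MeasurableSet Om) :
    Integrable (fun y => dens S lam Om y * Real.log (dens S lam Om y)) (_root_.stdGaussian N) := by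
  refine ((integrable_const (1 : ℝ)).add (integrable_dens_sq hS h0 hl h)).mono'
    ((measurable_dens S lam h).mul (measurable_dens S lam h).log).aestronglyMeasurable
    (ae_of_all _ fun y => ?_)
  rw [Real.norm_eq_abs, Pi.add_apply]
  exact xlogx_abs (dens_nonneg _ _ _ _)

lemma joint_eq (hS : onSphere S) (h0 : S.card ≠ 0) (hl : 0 ≤ lam) (h : MeasurableSet Om) :
    jointLaw N S lam Om = ENNReal.ofReal (∫ y, dens S lam Om y ∂(_root_.stdGaussian N)) := by
  rw [ofReal_integral_eq_lintegral_ofReal (integrable_dens hS h0 hl h)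
    (ae_of_all _ fun y => dens_nonneg _ _ _ _)]
  have := congrArg (fun m => m Set.univ) (restrict_map hS h0 hl h)
  simp only [withDensity_apply _ MeasurableSet.univ, Measure.restrict_univ,
    Measure.map_apply measurable_snd MeasurableSet.univ, Set.preimage_univ,
    Measure.restrict_apply_univ] at this
  exact this

lemma Q_eq (hS : onSphere S) (h0 : S.card ≠ 0) (hl : 0 ≤ lam) :
    Q N S lam = (_root_.stdGaussian N).withDensity
      (fun y => ENNReal.ofReal (dens S lam Set.univ y)) := by
  rw [← restrict_map hS h0 hl MeasurableSet.univ, Measure.restrict_univ, Q]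

lemma Q_zero (hS : onSphere S) (h0 : S.card ≠ 0) : Q N S 0 = _root_.stdGaussian N := by
  rw [Q_eq hS h0 le_rfl]
  have : (fun y => ENNReal.ofReal (dens S 0 Set.univ y)) = 1 := by
    ext y
    have hc : (0 : ℝ) < S.card := by positivity
    simp [dens, gg, hc.ne']
  rw [this, withDensity_one]

lemma condQ_eq (hS : onSphere S) (h0 : S.card ≠ 0) (hl : 0 ≤ lam) (h : MeasurableSet Om)
    {p : ℝ} (hp : 0 < p) (hpe : ∫ y, dens S lam Om y ∂(_root_.stdGaussian N) = p) :
    condQ N S lam Om = (_root_.stdGaussian N).withDensity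
      (fun y => ENNReal.ofReal (p⁻¹ * dens S lam Om y)) := by
  rw [condQ, ProbabilityTheory.cond, Measure.map_smul, restrict_map hS h0 hl h,
    joint_eq hS h0 hl h, hpe, ← ENNReal.ofReal_inv_of_pos hp, ← withDensity_smul]
  · congr 1
    ext y
    rw [Pi.smul_apply, smul_eq_mul, ENNReal.ofReal_mul (by positivity)]
  · exact (measurable_dens S lam h).ennreal_ofReal

lemma dens_add (S : Finset (V N)) (lam : ℝ) (Om : Set (V N × V N)) (y : V N) :
    dens S lam Set.univ y = dens S lam Om y + dens S lam Omᶜ y := by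
  simp only [dens]
  rw [← mul_add, ← Finset.sum_add_distrib]
  congr 1
  refine Finset.sum_congr rfl fun x _ => ?_
  by_cases hy : (x, y) ∈ Om <;> simp [Set.indicator, hy]

lemma integral_dens_univ (hS : onSphere S) (h0 : S.card ≠ 0) (hl : 0 ≤ lam) :
    ∫ y, dens S lam Set.univ y ∂(_root_.stdGaussian N) = 1 := by
  have h := joint_eq hS h0 hl MeasurableSet.univ
  rw [joint_apply S lam MeasurableSet.univ] at h
  simp only [Set.mem_univ, Set.ofPred_true, measure_univ, Finset.sum_const, nsmul_eq_mul,
    mul_one] at h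
  rw [ENNReal.inv_mul_cancel (by exact_mod_cast h0) (ENNReal.natCast_ne_top _)] at h
  have h2 := congrArg ENNReal.toReal h
  rw [ENNReal.toReal_ofReal (integral_nonneg fun y => dens_nonneg _ _ _ _)] at h2
  simpa using h2.symm

lemma integral_dens_compl_le (hS : onSphere S) (h0 : S.card ≠ 0) (hl : 0 ≤ lam)
    (h : MeasurableSet Om) {δ : ℝ} (hδ : 0 ≤ δ)
    (hh : ∀ x ∈ S, _root_.stdGaussian N {z | (x, fun i => Real.sqrt lam * x i + z i) ∉ Om}
      ≤ ENNReal.ofReal δ) :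
    ∫ y, dens S lam Omᶜ y ∂(_root_.stdGaussian N) ≤ δ := by
  rw [← ENNReal.ofReal_le_ofReal_iff hδ, ← joint_eq hS h0 hl h.compl,
    joint_apply S lam h.compl]
  calc (S.card : ℝ≥0∞)⁻¹ * ∑ x ∈ S,
        _root_.stdGaussian N {z | (x, fun i => Real.sqrt lam * x i + z i) ∈ Omᶜ}
      ≤ (S.card : ℝ≥0∞)⁻¹ * ∑ x ∈ S, ENNReal.ofReal δ := by
        gcongr with x hx
        exact hh x hx
    _ = ENNReal.ofReal δ := by
        rw [Finset.sum_const, nsmul_eq_mul, ← mul_assoc,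
          ENNReal.inv_mul_cancel (by exact_mod_cast h0) (ENNReal.natCast_ne_top _), one_mul]

lemma core_bound (hS : onSphere S) (h0 : S.card ≠ 0) (hl : 0 ≤ lam)
    (h : MeasurableSet Om) {δ : ℝ} (hδ : 0 ≤ δ) (hδ1 : δ < 1)
    (hh : ∀ x ∈ S, _root_.stdGaussian N {z | (x, fun i => Real.sqrt lam * x i + z i) ∉ Om}
      ≤ ENNReal.ofReal δ) :
    klReal (Q N S lam) (Q N S 0) ≤ klReal (condQ N S lam Om) (Q N S 0)
      + (Real.log 2 + (lam * δ + 1)) := by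
  obtain ⟨p, hpe⟩ : ∃ p, ∫ y, dens S lam Om y ∂(_root_.stdGaussian N) = p := ⟨_, rfl⟩
  have iA := integrable_dens hS h0 hl h
  have iB := integrable_dens hS h0 hl h.compl
  have hq := integral_dens_compl_le hS h0 hl h hδ hh
  have hq0 : 0 ≤ ∫ y, dens S lam Omᶜ y ∂(_root_.stdGaussian N) :=
    integral_nonneg fun y => dens_nonneg _ _ _ _
  have hsum : p + ∫ y, dens S lam Omᶜ y ∂(_root_.stdGaussian N) = 1 := by
    rw [← hpe, ← integral_add iA iB, ← integral_dens_univ hS h0 hl]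
    simp_rw [← dens_add]
  have hp : 0 < p := by linarith
  have hp1 : p ≤ 1 := by linarith
  rw [Q_zero hS h0, Q_eq hS h0 hl, condQ_eq hS h0 hl h hp hpe,
    kl_withDensity _ (measurable_dens S lam MeasurableSet.univ) (dens_nonneg _ _ _),
    kl_withDensity _ ((measurable_dens S lam h).const_mul _)
      (fun y => mul_nonneg (by positivity) (dens_nonneg _ _ _ _))]
  have iAl := integrable_dens_log hS h0 hl h
  have iBl := integrable_dens_log hS h0 hl h.compl
  have iL := integrable_dens_log hS h0 hl MeasurableSet.univ
  -- splitting
  have s1 : ∫ y, dens S lam Set.univ y * Real.log (dens S lam Set.univ y) ∂(_root_.stdGaussian N)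
      ≤ ∫ y, dens S lam Om y * Real.log (dens S lam Om y) ∂(_root_.stdGaussian N)
        + ∫ y, dens S lam Omᶜ y * Real.log (dens S lam Omᶜ y) ∂(_root_.stdGaussian N)
        + Real.log 2 := by
    have e2 : Real.log 2 = ∫ y, dens S lam Set.univ y * Real.log 2 ∂(_root_.stdGaussian N) := by
      rw [integral_mul_const, integral_dens_univ hS h0 hl, one_mul]
    have i3 := (integrable_dens hS h0 hl MeasurableSet.univ).mul_const (Real.log 2)
    conv_rhs => rw [e2]
    rw [← integral_add iAl iBl, ← integral_add (by exact iAl.add iBl) i3]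
    refine integral_mono iL ((iAl.add iBl).add i3) fun y => ?_
    simp only [Pi.add_apply]
    rw [dens_add S lam Om y]
    exact xlogx_mid (dens_nonneg _ _ _ _) (dens_nonneg _ _ _ _)
  -- bad part
  have s2 : ∫ y, dens S lam Omᶜ y * Real.log (dens S lam Omᶜ y) ∂(_root_.stdGaussian N)
      ≤ lam * δ + 1 := by
    have iR : Integrable (fun y => dens S lam Omᶜ y * lam
        + Real.exp (-lam) * ((S.card : ℝ)⁻¹ * ∑ x ∈ S, gg lam x y ^ 2)) (_root_.stdGaussian N) :=
      (iB.mul_const lam).add ((integrable_G hS hl).const_mul _)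
    calc _ ≤ ∫ y, (dens S lam Omᶜ y * lam
        + Real.exp (-lam) * ((S.card : ℝ)⁻¹ * ∑ x ∈ S, gg lam x y ^ 2))
          ∂(_root_.stdGaussian N) := by
          refine integral_mono iBl iR fun y => ?_
          have hb := dens_nonneg S lam Omᶜ y
          have hsq := dens_sq_le S h0 lam Omᶜ y
          have he := Real.exp_pos (-lam)
          have hm := mul_le_mul_of_nonneg_left hsq he.le
          simp only
          refine le_trans ?_ (add_le_add_right hm _)
          rcases eq_or_lt_of_le hb with hb | hb
          · simp [← hb]
          · have h5 : Real.log (dens S lam Omᶜ y)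
                ≤ lam + Real.exp (-lam) * dens S lam Omᶜ y := by
              have h6 := Real.add_one_le_exp (Real.log (dens S lam Omᶜ y) - lam)
              rw [sub_eq_add_neg, Real.exp_add, Real.exp_log hb] at h6
              linarith
            nlinarith [mul_le_mul_of_nonneg_left h5 hb.le]
      _ = (∫ y, dens S lam Omᶜ y ∂(_root_.stdGaussian N)) * lam + 1 := by
          rw [integral_add (iB.mul_const lam) ((integrable_G hS hl).const_mul _),
            integral_mul_const, integral_const_mul, integral_G hS h0 hl, ← Real.exp_add]
          simp
      _ ≤ lam * δ + 1 := by nlinarith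
  -- good part
  have s3 : ∫ y, dens S lam Om y * Real.log (dens S lam Om y) ∂(_root_.stdGaussian N)
      ≤ ∫ y, p⁻¹ * dens S lam Om y * Real.log (p⁻¹ * dens S lam Om y) ∂(_root_.stdGaussian N) := by
    have ef : ∀ y, p⁻¹ * dens S lam Om y * Real.log (p⁻¹ * dens S lam Om y)
        = p⁻¹ * (dens S lam Om y * Real.log (dens S lam Om y))
          + (p⁻¹ * Real.log p⁻¹) * dens S lam Om y := by
      intro y
      rcases eq_or_ne (dens S lam Om y) 0 with h7 | h7
      · simp [h7]
      · rw [Real.log_mul (inv_ne_zero hp.ne') h7]; ring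
    have iK : Integrable (fun y => p⁻¹ * dens S lam Om y * Real.log (p⁻¹ * dens S lam Om y))
        (_root_.stdGaussian N) := by
      simp_rw [ef]
      exact (iAl.const_mul _).add (iA.const_mul _)
    have k0 : 0 ≤ ∫ y, p⁻¹ * dens S lam Om y * Real.log (p⁻¹ * dens S lam Om y)
        ∂(_root_.stdGaussian N) := by
      have : ∫ y, (p⁻¹ * dens S lam Om y - 1) ∂(_root_.stdGaussian N) = 0 := by
        rw [integral_sub (iA.const_mul _) (integrable_const _), integral_const_mul, hpe]
        simp [hp.ne']
      rw [← this]
      refine integral_mono ((iA.const_mul _).sub (integrable_const _)) iK fun y => ?_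
      simp only
      have hf : 0 ≤ p⁻¹ * dens S lam Om y := mul_nonneg (by positivity) (dens_nonneg _ _ _ _)
      generalize p⁻¹ * dens S lam Om y = t at hf
      rcases eq_or_lt_of_le hf with hf | hf
      · simp [← hf]
      · have := mul_le_mul_of_nonneg_left (Real.one_sub_inv_le_log_of_pos hf) hf.le
        rw [mul_sub, mul_inv_cancel₀ hf.ne', mul_one] at this
        exact this
    have ek : ∫ y, p⁻¹ * dens S lam Om y * Real.log (p⁻¹ * dens S lam Om y)
        ∂(_root_.stdGaussian N) = p⁻¹ * ∫ y, dens S lam Om y * Real.log (dens S lam Om y)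
        ∂(_root_.stdGaussian N) + Real.log p⁻¹ := by
      simp_rw [ef]
      rw [integral_add (iAl.const_mul _) (iA.const_mul _), integral_const_mul,
        integral_const_mul, hpe]
      field_simp
    generalize (∫ y, p⁻¹ * dens S lam Om y * Real.log (p⁻¹ * dens S lam Om y)
        ∂(_root_.stdGaussian N)) = K at *
    generalize (∫ y, dens S lam Om y * Real.log (dens S lam Om y)
        ∂(_root_.stdGaussian N)) = J at *
    have hlog : 0 ≤ Real.log p⁻¹ := Real.log_nonneg ((one_le_inv₀ hp).2 hp1)
    have : J = p * (K - Real.log p⁻¹) := by rw [ek]; field_simp; ring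
    rw [this]
    nlinarith
  linarith

end core

/-- Proposition 5 of the paper. At `λ_N = 2 log M_N`, for any sequence of
measurable events `Ω_N` of uniformly high probability,
`D(Q_{λ_N,N} ‖ Q_{0,N}) ≤ D(Q̃_{λ_N,N} ‖ Q_{0,N}) + o(log M_N)`. -/
theorem statement8 (S : ∀ N : ℕ, Finset (V N)) (hsphere : ∀ N, onSphere (S N))
    (hM : Tendsto (fun N => (S N).card) atTop atTop)
    (Om : ∀ N : ℕ, Set (V N × V N)) (hmeas : ∀ N, MeasurableSet (Om N))
    (hhigh : uniformlyHigh S (fun N => 2 * Real.log (S N).card) Om) :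
    ∃ e : ℕ → ℝ,
      Tendsto (fun N => e N / Real.log (S N).card) atTop (nhds 0) ∧
      ∀ N : ℕ,
        klReal (Q N (S N) (2 * Real.log (S N).card)) (Q N (S N) 0)
          ≤ klReal (condQ N (S N) (2 * Real.log (S N).card) (Om N)) (Q N (S N) 0)
            + e N := by
  have hR : Tendsto (fun N => Real.log ((S N).card : ℝ)) atTop atTop :=
    Real.tendsto_log_atTop.comp (tendsto_natCast_atTop_atTop.comp hM)
  refine ⟨fun N => max 0 (klReal (Q N (S N) (2 * Real.log (S N).card)) (Q N (S N) 0)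
    - klReal (condQ N (S N) (2 * Real.log (S N).card) (Om N)) (Q N (S N) 0)), ?_, ?_⟩
  · rw [Metric.tendsto_nhds]
    intro ε hε
    obtain ⟨δ, hδ, hδ1, hδε⟩ : ∃ δ : ℝ, 0 < δ ∧ δ < 1 ∧ 4 * δ ≤ ε :=
      ⟨min (1 / 2) (ε / 4), by positivity, (min_le_left _ _).trans_lt (by norm_num),
        by linarith [min_le_right (1 / 2) (ε / 4)]⟩
    filter_upwards [hhigh δ hδ, hM.eventually_ge_atTop 1, hR.eventually_gt_atTop 0,
      hR.eventually_gt_atTop ((Real.log 2 + 1) / (ε / 2))] with N h1 h2 h3 h4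
    have hb := core_bound (hsphere N) (by omega) (by positivity) (hmeas N) hδ.le hδ1 h1
    rw [div_lt_iff₀ (by positivity)] at h4
    rw [Real.dist_eq, sub_zero, abs_of_nonneg (by positivity), div_lt_iff₀ h3, max_lt_iff]
    refine ⟨by positivity, ?_⟩
    nlinarith
  · intro N
    have := le_max_right 0 (klReal (Q N (S N) (2 * Real.log (S N).card)) (Q N (S N) 0)
      - klReal (condQ N (S N) (2 * Real.log (S N).card) (Om N)) (Q N (S N) 0))
    linarith
end
end

section
/- Consider the Gaussian additive model. For every N and every λ ≥ 0, the Kullback–Leibler divergence between the joint law of (X, Y) at SNR λ and the product measure P_N ⊗ Q_{λ,N} equals λ/2 − D(Q_{λ,N} ‖ Q_{0,N}); that is, the mutual information I(X; Y) = λ/2 − D(Q_{λ,N} ‖ Q_{0,N}). -/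
open MeasureTheory ProbabilityTheory Filter Real
open scoped ENNReal NNReal

noncomputable section

/-- Likelihood ratio of the shifted Gaussian. -/
def lr {N : ℕ} (s : ℝ) (x y : V N) : ℝ := Real.exp (s * inp x y - s ^ 2 / 2 * inp x x)

/-- Likelihood ratio of the mixture. -/
def mixLr {N : ℕ} (S : Finset (V N)) (s : ℝ) (y : V N) : ℝ :=
  (S.card : ℝ)⁻¹ * ∑ x ∈ S, lr s x y

lemma lr_pos {N : ℕ} (s : ℝ) (x y : V N) : 0 < lr s x y := Real.exp_pos _

lemma measurable_lr {N : ℕ} (s : ℝ) : Measurable (fun q : V N × V N => lr s q.1 q.2) := by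
  unfold lr inp
  fun_prop

lemma measurable_lr_right {N : ℕ} (s : ℝ) (x : V N) : Measurable (fun y : V N => lr s x y) := by
  unfold lr inp
  fun_prop

lemma measurable_lr_left {N : ℕ} (s : ℝ) (y : V N) : Measurable (fun x : V N => lr s x y) := by
  unfold lr inp
  fun_prop

lemma measurable_mixLr {N : ℕ} (S : Finset (V N)) (s : ℝ) : Measurable (mixLr S s) := by
  unfold mixLr
  exact (Finset.measurable_sum _ fun x _ => measurable_lr_right s x).const_mul _

lemma mixLr_pos {N : ℕ} {S : Finset (V N)} (hne : S.Nonempty) (s : ℝ) (y : V N) :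
    0 < mixLr S s y := by
  unfold mixLr
  have h1 : (0 : ℝ) < S.card := by exact_mod_cast hne.card_pos
  have h2 : 0 < ∑ x ∈ S, lr s x y := Finset.sum_pos (fun x _ => lr_pos s x y) hne
  positivity

lemma gaussian_shift (m : ℝ) :
    (gaussianReal 0 1).map (fun z => m + z)
      = (gaussianReal 0 1).withDensity
          (fun y => ENNReal.ofReal (Real.exp (m * y - m ^ 2 / 2))) := by
  rw [gaussianReal_map_const_add, gaussianReal_of_var_ne_zero _ one_ne_zero,
    gaussianReal_of_var_ne_zero _ one_ne_zero,
    ← withDensity_mul _ (measurable_gaussianPDF _ _) (by fun_prop)]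
  congr 1
  ext y
  simp only [Pi.mul_apply, gaussianPDF, gaussianPDFReal]
  rw [← ENNReal.ofReal_mul (by positivity), mul_assoc _ (Real.exp _) (Real.exp _), ← Real.exp_add]
  congr 3
  simp
  ring

lemma pi_withDensity {N : ℕ} (f : Fin N → ℝ → ℝ≥0∞) (hf : ∀ i, Measurable (f i))
    (μ : Measure ℝ) [IsProbabilityMeasure μ] [∀ i, SigmaFinite (μ.withDensity (f i))] :
    Measure.pi (fun i => μ.withDensity (f i))
      = (Measure.pi (fun _ : Fin N => μ)).withDensity (fun y => ∏ i, f i (y i)) := by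
  refine Measure.pi_eq fun s hs => ?_
  rw [withDensity_apply _ (MeasurableSet.univ_pi hs), ← lintegral_indicator (MeasurableSet.univ_pi hs)]
  have h1 : (Set.univ.pi s).indicator (fun y : Fin N → ℝ => ∏ i, f i (y i))
      = fun y => ∏ i, (s i).indicator (f i) (y i) := by
    ext y
    by_cases hy : y ∈ Set.univ.pi s
    · rw [Set.indicator_of_mem hy]
      refine Finset.prod_congr rfl fun i _ => ?_
      rw [Set.indicator_of_mem (hy i (Set.mem_univ i))]
    · rw [Set.indicator_of_notMem hy]
      simp only [Set.mem_pi, Set.mem_univ, true_imp_iff, not_forall] at hy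
      obtain ⟨i, hi⟩ := hy
      exact (Finset.prod_eq_zero (Finset.mem_univ i) (Set.indicator_of_notMem hi _)).symm
  have hm : ∀ i, Measurable ((s i).indicator (f i)) := fun i => (hf i).indicator (hs i)
  rw [h1, lintegral_prod_eq_prod_lintegral_of_indepFun Finset.univ
    (fun i (y : Fin N → ℝ) => (s i).indicator (f i) (y i))
    (iIndepFun_pi (X := fun i => (s i).indicator (f i)) fun i => (hm i).aemeasurable)
    (fun i => (hm i).comp (measurable_pi_apply i))]
  refine Finset.prod_congr rfl fun i _ => ?_
  rw [withDensity_apply _ (hs i), ← lintegral_indicator (hs i)]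
  exact (measurePreserving_eval (fun _ : Fin N => μ) i).lintegral_comp (hm i)

instance stdGaussian_prob (N : ℕ) : IsProbabilityMeasure (_root_.stdGaussian N) := by
  unfold _root_.stdGaussian
  infer_instance

lemma stdGaussian_shift {N : ℕ} (s : ℝ) (x : V N) :
    (_root_.stdGaussian N).map (fun z i => s * x i + z i)
      = (_root_.stdGaussian N).withDensity (fun y => ENNReal.ofReal (lr s x y)) := by
  unfold _root_.stdGaussian
  have : ∀ i, SigmaFinite ((gaussianReal 0 1).map (fun z => s * x i + z)) := fun i => by
    rw [gaussianReal_map_const_add]; infer_instance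
  rw [Measure.pi_map_pi (f := fun i z => s * x i + z) (fun i => by fun_prop)]
  have this' : ∀ i, SigmaFinite ((gaussianReal 0 1).withDensity
      (fun y => ENNReal.ofReal (Real.exp (s * x i * y - (s * x i) ^ 2 / 2)))) := fun i => by
    rw [← gaussian_shift]; exact this i
  simp_rw [gaussian_shift]
  rw [pi_withDensity (fun i y => ENNReal.ofReal (Real.exp (s * x i * y - (s * x i) ^ 2 / 2)))
    (fun i => by fun_prop)]
  congr 1
  ext y
  rw [← ENNReal.ofReal_prod_of_nonneg (fun i _ => (Real.exp_pos _).le), ← Real.exp_sum]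
  unfold lr inp
  congr 2
  rw [Finset.sum_sub_distrib, Finset.mul_sum, Finset.mul_sum]
  congr 1 <;> exact Finset.sum_congr rfl fun i _ => by ring

lemma unifOn_prob {N : ℕ} {S : Finset (V N)} (hne : S.Nonempty) :
    IsProbabilityMeasure (unifOn S) := by
  constructor
  simp only [unifOn, Measure.smul_apply, Measure.coe_finsetSum, Finset.sum_apply, measure_univ,
    Finset.sum_const, smul_eq_mul, nsmul_eq_mul, mul_one]
  exact ENNReal.inv_mul_cancel (by exact_mod_cast hne.card_pos.ne') (by simp)

lemma ae_unifOn {N : ℕ} (S : Finset (V N)) : ∀ᵐ x ∂(unifOn S), x ∈ S := by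
  rw [ae_iff]
  simp only [unifOn, Measure.smul_apply, Measure.coe_finsetSum, Finset.sum_apply, smul_eq_mul]
  rw [Finset.sum_eq_zero, mul_zero]
  intro x hx
  rw [Measure.dirac_apply]
  simp [hx]

lemma integrable_unifOn {N : ℕ} {S : Finset (V N)} (hne : S.Nonempty) (f : V N → ℝ) :
    Integrable f (unifOn S) := by
  unfold unifOn
  refine Integrable.smul_measure ?_ (by simp [hne.ne_empty])
  rw [integrable_finsetSum_measure]
  intro x _
  exact integrable_dirac (by simp)

lemma lintegral_unifOn {N : ℕ} (S : Finset (V N)) (f : V N → ℝ≥0∞) :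
    ∫⁻ x, f x ∂(unifOn S) = (S.card : ℝ≥0∞)⁻¹ * ∑ x ∈ S, f x := by
  unfold unifOn
  rw [lintegral_smul_measure, lintegral_finsetSum_measure]
  simp

lemma ofReal_mixLr {N : ℕ} {S : Finset (V N)} (hne : S.Nonempty) (s : ℝ) (y : V N) :
    ENNReal.ofReal (mixLr S s y) = ∫⁻ x, ENNReal.ofReal (lr s x y) ∂(unifOn S) := by
  rw [lintegral_unifOn, mixLr, ENNReal.ofReal_mul (by positivity),
    ENNReal.ofReal_inv_of_pos (by exact_mod_cast hne.card_pos), ENNReal.ofReal_natCast,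
    ENNReal.ofReal_sum_of_nonneg (fun x _ => (lr_pos s x y).le)]

lemma measurable_joint_map {N : ℕ} (s : ℝ) :
    Measurable (fun q : V N × V N => ((q.1, fun i => s * q.1 i + q.2 i) : V N × V N)) := by
  fun_prop

lemma jointLaw_eq {N : ℕ} {S : Finset (V N)} (hne : S.Nonempty) (lam : ℝ) :
    jointLaw N S lam = ((unifOn S).prod (_root_.stdGaussian N)).withDensity
      (fun q => ENNReal.ofReal (lr (Real.sqrt lam) q.1 q.2)) := by
  have := unifOn_prob hne
  have hl := (measurable_lr (N := N) (Real.sqrt lam)).ennreal_ofReal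
  refine Measure.ext_of_lintegral _ fun f hf => ?_
  rw [jointLaw, lintegral_map hf (measurable_joint_map _), lintegral_withDensity_eq_lintegral_mul _ hl hf,
    lintegral_prod _ (by fun_prop), lintegral_prod _ (hl.mul hf).aemeasurable]
  refine lintegral_congr fun x => ?_
  have hfx : Measurable (fun y => f (x, y)) := by fun_prop
  rw [← lintegral_map (f := fun y => f (x, y)) (g := fun (z : V N) i => Real.sqrt lam * x i + z i)
    hfx (by fun_prop), stdGaussian_shift, lintegral_withDensity_eq_lintegral_mul _
      (measurable_lr_right _ x).ennreal_ofReal hfx]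
  rfl

lemma Q_eq_s11 {N : ℕ} {S : Finset (V N)} (hne : S.Nonempty) (lam : ℝ) :
    Q N S lam = (_root_.stdGaussian N).withDensity
      (fun y => ENNReal.ofReal (mixLr S (Real.sqrt lam) y)) := by
  have := unifOn_prob hne
  have hl := (measurable_lr (N := N) (Real.sqrt lam)).ennreal_ofReal
  refine Measure.ext_of_lintegral _ fun f hf => ?_
  have hf2 : Measurable (fun q : V N × V N => f q.2) := hf.comp measurable_snd
  rw [Q, jointLaw_eq hne, lintegral_map hf measurable_snd,
    lintegral_withDensity_eq_lintegral_mul _ hl hf2,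
    lintegral_withDensity_eq_lintegral_mul _ (measurable_mixLr _ _).ennreal_ofReal hf,
    lintegral_prod_symm _ (hl.mul hf2).aemeasurable]
  refine lintegral_congr fun y => ?_
  simp only [Pi.mul_apply, ofReal_mixLr hne]
  rw [lintegral_mul_const]
  exact (measurable_lr_left _ y).ennreal_ofReal

lemma Q_zero_s11 {N : ℕ} {S : Finset (V N)} (hne : S.Nonempty) :
    Q N S 0 = _root_.stdGaussian N := by
  rw [Q_eq_s11 hne]
  have : (fun y => ENNReal.ofReal (mixLr S (Real.sqrt 0) y)) = 1 := by
    ext y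
    have : (S.card : ℝ) ≠ 0 := by exact_mod_cast hne.card_pos.ne'
    simp [mixLr, lr, this]
  rw [this, withDensity_one]

lemma integrable_coord {N : ℕ} (i : Fin N) :
    Integrable (fun z : V N => z i) (_root_.stdGaussian N) := by
  unfold _root_.stdGaussian
  exact integrable_eval (memLp_one_iff_integrable.1 (memLp_id_gaussianReal' 1 (by simp)))

lemma integral_coord {N : ℕ} (i : Fin N) :
    ∫ z : V N, z i ∂(_root_.stdGaussian N) = 0 := by
  unfold _root_.stdGaussian
  rw [integral_eval, integral_id_gaussianReal]

lemma integrable_inp {N : ℕ} {S : Finset (V N)} (hne : S.Nonempty) :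
    Integrable (fun q : V N × V N => inp q.1 q.2)
      ((unifOn S).prod (_root_.stdGaussian N)) := by
  have := unifOn_prob hne
  unfold inp
  refine integrable_finsetSum _ fun i _ => ?_
  exact (integrable_unifOn hne (fun x => x i)).mul_prod (integrable_coord i)

lemma integral_inp {N : ℕ} {S : Finset (V N)} (hne : S.Nonempty) :
    ∫ q : V N × V N, inp q.1 q.2 ∂((unifOn S).prod (_root_.stdGaussian N)) = 0 := by
  have := unifOn_prob hne
  unfold inp
  rw [integral_finsetSum]
  · refine Finset.sum_eq_zero fun i _ => ?_
    rw [integral_prod_mul (fun x : V N => x i) (fun z : V N => z i), integral_coord, mul_zero]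
  · intro i _
    exact (integrable_unifOn hne (fun x => x i)).mul_prod (integrable_coord i)

lemma log_lr_shift {N : ℕ} (s : ℝ) (x z : V N) :
    Real.log (lr s x (fun i => s * x i + z i)) = s ^ 2 / 2 * inp x x + s * inp x z := by
  rw [lr, Real.log_exp]
  have : inp x (fun i => s * x i + z i) = s * inp x x + inp x z := by
    unfold inp
    rw [Finset.mul_sum, ← Finset.sum_add_distrib]
    exact Finset.sum_congr rfl fun i _ => by ring
  rw [this]; ring

lemma measurable_log_lr {N : ℕ} (s : ℝ) :
    Measurable (fun q : V N × V N => Real.log (lr s q.1 q.2)) := (measurable_lr s).log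

lemma integrable_log_lr_comp {N : ℕ} {S : Finset (V N)} (hne : S.Nonempty) (s : ℝ) :
    Integrable (fun q : V N × V N => s ^ 2 / 2 * inp q.1 q.1 + s * inp q.1 q.2)
      ((unifOn S).prod (_root_.stdGaussian N)) := by
  have := unifOn_prob hne
  refine Integrable.add ?_ ((integrable_inp hne).const_mul s)
  exact ((integrable_unifOn hne (fun x => s ^ 2 / 2 * inp x x)).comp_fst _)

lemma integrable_log_lr {N : ℕ} {S : Finset (V N)} (hne : S.Nonempty) (lam : ℝ) :
    Integrable (fun q : V N × V N => Real.log (lr (Real.sqrt lam) q.1 q.2))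
      (jointLaw N S lam) := by
  rw [jointLaw, integrable_map_measure (measurable_log_lr _).aestronglyMeasurable
    (measurable_joint_map _).aemeasurable]
  refine (integrable_log_lr_comp hne (Real.sqrt lam)).congr (ae_of_all _ fun q => ?_)
  exact (log_lr_shift _ _ _).symm

lemma integral_log_lr {N : ℕ} {S : Finset (V N)} (hne : S.Nonempty) (hS : onSphere S)
    (lam : ℝ) (hlam : 0 ≤ lam) :
    ∫ q : V N × V N, Real.log (lr (Real.sqrt lam) q.1 q.2) ∂(jointLaw N S lam) = lam / 2 := by
  have := unifOn_prob hne
  rw [jointLaw, integral_map (measurable_joint_map _).aemeasurable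
    (measurable_log_lr _).aestronglyMeasurable]
  simp only [log_lr_shift]
  rw [integral_add ((integrable_unifOn hne (fun x => Real.sqrt lam ^ 2 / 2 * inp x x)).comp_fst _)
    ((integrable_inp hne).const_mul _),
    integral_const_mul _ (fun q : V N × V N => inp q.1 q.2), integral_inp hne, mul_zero, add_zero]
  have h : ∀ᵐ q ∂((unifOn S).prod (_root_.stdGaussian N)),
      Real.sqrt lam ^ 2 / 2 * inp q.1 q.1 = lam / 2 := by
    have := Measure.quasiMeasurePreserving_fst (μ := unifOn S)
      (ν := _root_.stdGaussian N) |>.ae (ae_unifOn S)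
    filter_upwards [this] with q hq
    have h1 := hS q.1 hq
    have h2 : inp q.1 q.1 = 1 := by
      rw [← h1]; unfold inp; exact Finset.sum_congr rfl fun i _ => by ring
    rw [h2, Real.sq_sqrt hlam, mul_one]
  rw [integral_congr_ae h]
  simp

lemma inp_shift_abs_integrable {N : ℕ} {S : Finset (V N)} (hne : S.Nonempty) (lam : ℝ) (a : V N) :
    Integrable (fun y : V N => inp a y) (Q N S lam) := by
  have := unifOn_prob hne
  have hm : Measurable (fun y : V N => inp a y) := by unfold inp; fun_prop
  rw [Q, integrable_map_measure hm.aestronglyMeasurable measurable_snd.aemeasurable, jointLaw,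
    integrable_map_measure (hm.comp measurable_snd).aestronglyMeasurable
      (measurable_joint_map _).aemeasurable]
  change Integrable (fun q : V N × V N => ∑ i, a i * (Real.sqrt lam * q.1 i + q.2 i)) _
  refine integrable_finsetSum _ fun i _ => ?_
  refine Integrable.const_mul ?_ _
  refine Integrable.add ?_ ?_
  · exact (integrable_unifOn hne (fun x => Real.sqrt lam * x i)).comp_fst _
  · exact (integrable_coord i).comp_snd _

lemma abs_log_mixLr_le {N : ℕ} {S : Finset (V N)} (hne : S.Nonempty) (s : ℝ) (y : V N) :
    |Real.log (mixLr S s y)| ≤ ∑ x ∈ S, |s * inp x y - s ^ 2 / 2 * inp x x| := by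
  set B := ∑ x ∈ S, |s * inp x y - s ^ 2 / 2 * inp x x| with hB
  have hx : ∀ x ∈ S, |s * inp x y - s ^ 2 / 2 * inp x x| ≤ B := fun x hx =>
    Finset.single_le_sum (f := fun x => |s * inp x y - s ^ 2 / 2 * inp x x|)
      (fun _ _ => abs_nonneg _) hx
  have hc : (0 : ℝ) < S.card := by exact_mod_cast hne.card_pos
  have hup : mixLr S s y ≤ Real.exp B := by
    unfold mixLr
    rw [inv_mul_le_iff₀ hc, ← nsmul_eq_mul]
    exact Finset.sum_le_card_nsmul _ _ _ fun x h =>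
      Real.exp_le_exp.2 (abs_le.1 (hx x h)).2
  have hlo : Real.exp (-B) ≤ mixLr S s y := by
    unfold mixLr
    rw [le_inv_mul_iff₀ hc, ← nsmul_eq_mul]
    exact Finset.card_nsmul_le_sum _ _ _ fun x h =>
      Real.exp_le_exp.2 (abs_le.1 (hx x h)).1
  have hp := mixLr_pos hne s y
  rw [abs_le]
  exact ⟨(Real.le_log_iff_exp_le hp).2 hlo, (Real.log_le_iff_le_exp hp).2 hup⟩

instance jointLaw_prob {N : ℕ} {S : Finset (V N)} [IsProbabilityMeasure (unifOn S)] (lam : ℝ) :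
    IsProbabilityMeasure (jointLaw N S lam) :=
  Measure.isProbabilityMeasure_map (measurable_joint_map _).aemeasurable

instance Q_prob {N : ℕ} {S : Finset (V N)} [IsProbabilityMeasure (unifOn S)] (lam : ℝ) :
    IsProbabilityMeasure (Q N S lam) :=
  Measure.isProbabilityMeasure_map measurable_snd.aemeasurable

lemma integrable_log_mixLr {N : ℕ} {S : Finset (V N)} (hne : S.Nonempty) (lam : ℝ) :
    Integrable (fun y => Real.log (mixLr S (Real.sqrt lam) y)) (Q N S lam) := by
  have := unifOn_prob hne
  refine Integrable.mono' (g := fun y => ∑ x ∈ S,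
    |Real.sqrt lam * inp x y - Real.sqrt lam ^ 2 / 2 * inp x x|) ?_
    (measurable_mixLr _ _).log.aestronglyMeasurable
    (ae_of_all _ fun y => abs_log_mixLr_le hne _ y)
  refine integrable_finsetSum _ fun x _ => Integrable.abs ?_
  exact ((inp_shift_abs_integrable hne lam x).const_mul _).sub (integrable_const _)

lemma klReal_Q {N : ℕ} {S : Finset (V N)} (hne : S.Nonempty) (lam : ℝ) :
    klReal (Q N S lam) (Q N S 0)
      = ∫ y, Real.log (mixLr S (Real.sqrt lam) y) ∂(Q N S lam) := by
  unfold klReal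
  rw [Q_zero_s11 hne]
  have hac : Q N S lam ≪ _root_.stdGaussian N := by
    rw [Q_eq_s11 hne]; exact withDensity_absolutelyContinuous _ _
  refine integral_congr_ae (hac.ae_le ?_)
  have h := Measure.rnDeriv_withDensity (_root_.stdGaussian N)
    (measurable_mixLr S (Real.sqrt lam)).ennreal_ofReal
  rw [← Q_eq_s11 hne] at h
  filter_upwards [h] with y hy
  rw [hy, ENNReal.toReal_ofReal (mixLr_pos hne _ y).le]

lemma klReal_joint {N : ℕ} {S : Finset (V N)} (hne : S.Nonempty) (lam : ℝ) :
    klReal (jointLaw N S lam) ((unifOn S).prod (Q N S lam))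
      = ∫ q, (Real.log (lr (Real.sqrt lam) q.1 q.2) - Real.log (mixLr S (Real.sqrt lam) q.2))
          ∂(jointLaw N S lam) := by
  have := unifOn_prob hne
  unfold klReal
  set s := Real.sqrt lam
  have hac : jointLaw N S lam ≪ (unifOn S).prod (_root_.stdGaussian N) := by
    rw [jointLaw_eq hne]; exact withDensity_absolutelyContinuous _ _
  have hmix : Measurable (fun q : V N × V N => ENNReal.ofReal (mixLr S s q.2)) :=
    ((measurable_mixLr S s).comp measurable_snd).ennreal_ofReal
  have hprod : (unifOn S).prod (Q N S lam) = ((unifOn S).prod (_root_.stdGaussian N)).withDensity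
      (fun q => ENNReal.ofReal (mixLr S s q.2)) := by
    rw [Q_eq_s11 hne, prod_withDensity_right (measurable_mixLr S s).ennreal_ofReal]
  refine integral_congr_ae (hac.ae_le ?_)
  have h1 := Measure.rnDeriv_withDensity ((unifOn S).prod (_root_.stdGaussian N))
    (measurable_lr s).ennreal_ofReal
  rw [← jointLaw_eq hne] at h1
  have h2 := Measure.rnDeriv_withDensity_right (jointLaw N S lam)
    ((unifOn S).prod (_root_.stdGaussian N)) hmix.aemeasurable
    (ae_of_all _ fun q => by simpa using mixLr_pos hne s q.2)
    (ae_of_all _ fun q => ENNReal.ofReal_ne_top)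
  rw [← hprod] at h2
  filter_upwards [h1, h2] with q h1 h2
  have hm := mixLr_pos hne s q.2
  have hl := lr_pos s q.1 q.2
  rw [h2, h1, ENNReal.toReal_mul, ENNReal.toReal_inv, ENNReal.toReal_ofReal hm.le,
    ENNReal.toReal_ofReal hl.le, Real.log_mul (inv_ne_zero hm.ne') hl.ne', Real.log_inv]
  ring

/-- Lemma 1 of the paper. The mutual information `I(X;Y)`, i.e. the KL
divergence between the joint law of `(X,Y)` at SNR `λ` and the product of its marginals
`P_N ⊗ Q_{λ,N}`, equals `λ/2 - D(Q_{λ,N} ‖ Q_{0,N})`. -/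
theorem statement11 (N : ℕ) (S : Finset (V N)) (hne : S.Nonempty) (hsphere : onSphere S)
    (lam : ℝ) (hlam : 0 ≤ lam) :
    klReal (jointLaw N S lam) ((unifOn S).prod (Q N S lam))
      = lam / 2 - klReal (Q N S lam) (Q N S 0) := by
  have := unifOn_prob hne
  have hlog : Measurable (fun y : V N => Real.log (mixLr S (Real.sqrt lam) y)) :=
    (measurable_mixLr S _).log
  have hint : Integrable (fun q : V N × V N => Real.log (mixLr S (Real.sqrt lam) q.2))
      (jointLaw N S lam) :=
    (integrable_map_measure hlog.aestronglyMeasurable measurable_snd.aemeasurable).1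
      (integrable_log_mixLr hne lam)
  rw [klReal_joint hne, klReal_Q hne, integral_sub (integrable_log_lr hne lam) hint,
    integral_log_lr hne hsphere lam hlam]
  congr 1
  rw [Q, integral_map measurable_snd.aemeasurable hlog.aestronglyMeasurable]
end
end
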